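/- ITL^FS does not derive the constant domain axiom nor the backward induction axiom: ITL^FS ⊬ □(p∨q) → □p ∨ ◇q, and ITL^FS ⊬ □(p∨q) ∧ □(◦q→q) → □p ∨ q. -/

import Mathlib

/-- Formulas of the language `L` of intuitionistic linear temporal logic. -/
inductive Formula : Type
  | bot : Formula
  | var : ℕ → Formula
  | and : Formula → Formula → Formula
  | or : Formula → Formula → Formula
  | impl : Formula → Formula → Formula
  | next : Formula → Formula
  | diam : Formula → Formula
  | box : Formula → Formula
deriving DecidableEq

namespace Formula

/-- `¬φ` abbreviates `φ → ⊥`. -/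
def neg (φ : Formula) : Formula := impl φ bot

/-- `φ ↔ ψ` abbreviates `(φ → ψ) ∧ (ψ → φ)`. -/
def iff (φ ψ : Formula) : Formula := and (impl φ ψ) (impl ψ φ)

end Formula

/-- Derivability in `ITL⁰` extended with an additional set of axioms `Ax`.
The intuitionistic propositional tautologies are generated by a standard
complete Hilbert-style axiomatization of intuitionistic propositional logic
(closed under modus ponens). -/
inductive ITL (Ax : Formula → Prop) : Formula → Prop
  | extra {φ} : Ax φ → ITL Ax φ
  -- (i) intuitionistic propositional axioms
  | then1 (φ ψ : Formula) : ITL Ax (.impl φ (.impl ψ φ))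
  | then2 (φ ψ χ : Formula) :
      ITL Ax (.impl (.impl φ (.impl ψ χ)) (.impl (.impl φ ψ) (.impl φ χ)))
  | andE1 (φ ψ : Formula) : ITL Ax (.impl (.and φ ψ) φ)
  | andE2 (φ ψ : Formula) : ITL Ax (.impl (.and φ ψ) ψ)
  | andI (φ ψ : Formula) : ITL Ax (.impl φ (.impl ψ (.and φ ψ)))
  | orI1 (φ ψ : Formula) : ITL Ax (.impl φ (.or φ ψ))
  | orI2 (φ ψ : Formula) : ITL Ax (.impl ψ (.or φ ψ))
  | orE (φ ψ χ : Formula) :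
      ITL Ax (.impl (.impl φ χ) (.impl (.impl ψ χ) (.impl (.or φ ψ) χ)))
  | botE (φ : Formula) : ITL Ax (.impl .bot φ)
  -- (ii)–(x) temporal axioms
  | nextBot : ITL Ax (.neg (.next .bot))
  | nextAnd (φ ψ : Formula) :
      ITL Ax (.iff (.next (.and φ ψ)) (.and (.next φ) (.next ψ)))
  | nextOr (φ ψ : Formula) :
      ITL Ax (.iff (.next (.or φ ψ)) (.or (.next φ) (.next ψ)))
  | nextK (φ ψ : Formula) :
      ITL Ax (.impl (.next (.impl φ ψ)) (.impl (.next φ) (.next ψ)))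
  | boxK (φ ψ : Formula) :
      ITL Ax (.impl (.box (.impl φ ψ)) (.impl (.box φ) (.box ψ)))
  | diamK (φ ψ : Formula) :
      ITL Ax (.impl (.box (.impl φ ψ)) (.impl (.diam φ) (.diam ψ)))
  | diamOr (φ ψ : Formula) :
      ITL Ax (.impl (.diam (.or φ ψ)) (.or (.diam φ) (.diam ψ)))
  | boxFix (φ : Formula) : ITL Ax (.impl (.box φ) (.and φ (.next (.box φ))))
  | diamFix (φ : Formula) : ITL Ax (.impl (.or φ (.next (.diam φ))) (.diam φ))
  -- rules (xi)–(xiv)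
  | ind1 {φ : Formula} : ITL Ax (.impl φ (.next φ)) → ITL Ax (.impl φ (.box φ))
  | ind2 {φ : Formula} : ITL Ax (.impl (.next φ) φ) → ITL Ax (.impl (.diam φ) φ)
  | mp {φ ψ : Formula} : ITL Ax (.impl φ ψ) → ITL Ax φ → ITL Ax ψ
  | nec {φ : Formula} : ITL Ax φ → ITL Ax (.next φ)

/-- The Fischer Servi axiom schemes FS◦ and FS◇. -/
def FSAx : Formula → Prop := fun χ => ∃ φ ψ : Formula,
  χ = .impl (.impl (.next φ) (.next ψ)) (.next (.impl φ ψ)) ∨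
  χ = .impl (.impl (.diam φ) (.box ψ)) (.box (.impl φ ψ))

/-- The constant domain axiom scheme CD. -/
def CDAx : Formula → Prop := fun χ => ∃ φ ψ : Formula,
  χ = .impl (.box (.or φ ψ)) (.or (.box φ) (.diam ψ))

/-- The logic ITL⁰. -/
def ITL0 : Formula → Prop := ITL (fun _ => False)

/-- The logic ITL^FS = ITL⁰ + FS◦ + FS◇. -/
def ITLFS : Formula → Prop := ITL FSAx

/-- The logic ITL^CD = ITL⁰ + CD. -/
def ITLCD : Formula → Prop := ITL CDAx

/-- The logic ITL¹ = ITL^FS + ITL^CD. -/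
def ITL1 : Formula → Prop := ITL (fun χ => FSAx χ ∨ CDAx χ)

/-- A valuation on a dynamical topological system `(X, T, S)`: a map from
formulas to open sets satisfying the semantic clauses. -/
structure DTValuation (X : Type) (T : TopologicalSpace X) (S : X → X) where
  val : Formula → Set X
  isOpen_val : ∀ φ, @IsOpen X T (val φ)
  val_bot : val .bot = ∅
  val_and : ∀ φ ψ, val (.and φ ψ) = val φ ∩ val ψ
  val_or : ∀ φ ψ, val (.or φ ψ) = val φ ∪ val ψ
  val_impl : ∀ φ ψ, val (.impl φ ψ) = @interior X T ((val φ)ᶜ ∪ val ψ)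
  val_next : ∀ φ, val (.next φ) = S ⁻¹' val φ
  val_diam : ∀ φ, val (.diam φ) = ⋃ n : ℕ, (S^[n]) ⁻¹' val φ
  val_box : ∀ φ, val (.box φ) =
    ⋃₀ {U : Set X | @IsOpen X T U ∧ S '' U ⊆ U ∧ U ⊆ val φ}

/-- The up-set topology of a preorder: the open sets are the upward closed sets. -/
def upsetTopology (X : Type) [Preorder X] : TopologicalSpace X where
  IsOpen U := IsUpperSet U
  isOpen_univ := isUpperSet_univ
  isOpen_inter := fun _ _ hU hV => hU.inter hV
  isOpen_sUnion := fun _ hs => isUpperSet_sUnion hs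

/-- The propositional variables `p` and `q`. -/
def pVar : Formula := .var 0
def qVar : Formula := .var 1

open TopologicalSpace

section Soundness

variable {X : Type*} [TopologicalSpace X]

lemma TopologicalSpace.Opens.mem_of_mem_himp {U V : Opens X} {x : X} (h : x ∈ U ⇨ V)
    (hx : x ∈ U) : x ∈ V :=
  (himp_inf_le : (U ⇨ V) ⊓ U ≤ V) ⟨h, hx⟩

/-- The interpretation of formulas as open sets of the dynamical system `(X, S)`, given an
interpretation `v` of the propositional variables. -/
def openVal (S : C(X, X)) (v : ℕ → Opens X) : Formula → Opens X
  | .bot => ⊥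
  | .var n => v n
  | .and φ ψ => openVal S v φ ⊓ openVal S v ψ
  | .or φ ψ => openVal S v φ ⊔ openVal S v ψ
  | .impl φ ψ => openVal S v φ ⇨ openVal S v ψ
  | .next φ => Opens.comap S (openVal S v φ)
  | .diam φ => ⨆ n : ℕ, (Opens.comap S)^[n] (openVal S v φ)
  | .box φ => sSup {U | U ≤ Opens.comap S U ∧ U ≤ openVal S v φ}

variable {S : C(X, X)} {v : ℕ → Opens X}

lemma mem_iterate_comap {U : Opens X} {n : ℕ} {x : X} :
    x ∈ (Opens.comap S)^[n] U ↔ S^[n] x ∈ U := by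
  induction n generalizing x with
  | zero => rfl
  | succ n ih => rw [Function.iterate_succ_apply', Opens.mem_comap, ih]; rfl

lemma mem_openVal_diam {φ : Formula} {x : X} :
    x ∈ openVal S v (.diam φ) ↔ ∃ n, S^[n] x ∈ openVal S v φ := by
  simp only [openVal, Opens.mem_iSup, mem_iterate_comap]

lemma le_openVal_box {φ : Formula} {U : Opens X} (hS : U ≤ Opens.comap S U)
    (hφ : U ≤ openVal S v φ) : U ≤ openVal S v (.box φ) :=
  le_sSup ⟨hS, hφ⟩

lemma openVal_box_le (φ : Formula) : openVal S v (.box φ) ≤ openVal S v φ :=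
  sSup_le fun _ hU => hU.2

lemma openVal_box_le_comap (φ : Formula) :
    openVal S v (.box φ) ≤ Opens.comap S (openVal S v (.box φ)) :=
  sSup_le fun _ hU => hU.1.trans (Opens.comap_mono S (le_sSup hU))

lemma iterate_mem_of_le_comap {U : Opens X} (hU : U ≤ Opens.comap S U) {x : X} (hx : x ∈ U)
    (n : ℕ) : S^[n] x ∈ U := by
  induction n with
  | zero => exact hx
  | succ n ih => rw [Function.iterate_succ_apply']; exact hU ih

lemma mem_of_iterate_mem_of_comap_le {U : Opens X} (hU : Opens.comap S U ≤ U) {x : X} {n : ℕ}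
    (hx : S^[n] x ∈ U) : x ∈ U := by
  induction n generalizing x with
  | zero => exact hx
  | succ n ih => exact hU (ih hx)

lemma isOpenMap_iterate {f : X → X} (hf : IsOpenMap f) (n : ℕ) : IsOpenMap f^[n] := by
  induction n with
  | zero => exact IsOpenMap.id
  | succ n ih => exact ih.comp hf

lemma comap_himp_comap_le (hS : IsOpenMap S) (U V : Opens X) :
    (Opens.comap S U ⇨ Opens.comap S V) ≤ Opens.comap S (U ⇨ V) := by
  intro x hx
  have h : (⟨_, hS _ (Opens.comap S U ⇨ Opens.comap S V).isOpen⟩ : Opens X) ≤ U ⇨ V := by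
    rw [le_himp_iff]
    rintro _ ⟨⟨y, hy, rfl⟩, hyU⟩
    exact Opens.mem_of_mem_himp (U := Opens.comap S U) (V := Opens.comap S V) hy hyU
  exact h ⟨x, hx, rfl⟩

lemma diam_himp_box_le (hS : IsOpenMap S) (φ ψ : Formula) :
    openVal S v (.impl (.diam φ) (.box ψ)) ≤ openVal S v (.box (.impl φ ψ)) := by
  let W := openVal S v (.impl (.diam φ) (.box ψ))
  let orbit : Opens X :=
    ⟨⋃ n : ℕ, S^[n] '' W, isOpen_iUnion fun n => isOpenMap_iterate hS n _ W.isOpen⟩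
  have h : orbit ≤ openVal S v (.box (.impl φ ψ)) := by
    apply le_openVal_box
    · intro y hy
      obtain ⟨n, x, hx, rfl⟩ := Set.mem_iUnion.1 hy
      exact Set.mem_iUnion.2 ⟨n + 1, x, hx, Function.iterate_succ_apply' _ _ _⟩
    · refine le_himp_iff.2 ?_
      rintro y ⟨hy, hyφ⟩
      obtain ⟨n, x, hx, rfl⟩ := Set.mem_iUnion.1 hy
      have hx' : x ∈ openVal S v (.box ψ) :=
        Opens.mem_of_mem_himp hx (mem_openVal_diam.2 ⟨n, hyφ⟩)
      exact openVal_box_le ψ (iterate_mem_of_le_comap (openVal_box_le_comap ψ) hx' n)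
  exact fun x hx => h (Set.mem_iUnion.2 ⟨0, x, hx, rfl⟩)

lemma openVal_impl_eq_top {φ ψ : Formula} :
    openVal S v (.impl φ ψ) = ⊤ ↔ openVal S v φ ≤ openVal S v ψ :=
  himp_eq_top_iff

/-- Soundness of `ITL^FS` for dynamical systems given by a continuous open map. -/
theorem ITLFS.openVal_eq_top (hS : IsOpenMap S) (v : ℕ → Opens X) {φ : Formula} (h : ITLFS φ) :
    openVal S v φ = ⊤ := by
  induction h with
  | extra h =>
    obtain ⟨φ, ψ, rfl | rfl⟩ := h
    · exact openVal_impl_eq_top.2 (comap_himp_comap_le hS _ _)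
    · exact openVal_impl_eq_top.2 (diam_himp_box_le hS φ ψ)
  | then1 φ ψ => exact openVal_impl_eq_top.2 le_himp
  | then2 φ ψ χ =>
    refine openVal_impl_eq_top.2 (le_himp_iff.2 (le_himp_iff.2 ?_))
    rintro x ⟨⟨h₁, h₂⟩, hx⟩
    exact Opens.mem_of_mem_himp (Opens.mem_of_mem_himp h₁ hx) (Opens.mem_of_mem_himp h₂ hx)
  | andE1 φ ψ => exact openVal_impl_eq_top.2 inf_le_left
  | andE2 φ ψ => exact openVal_impl_eq_top.2 inf_le_right
  | andI φ ψ => exact openVal_impl_eq_top.2 (le_himp_iff.2 le_rfl)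
  | orI1 φ ψ => exact openVal_impl_eq_top.2 le_sup_left
  | orI2 φ ψ => exact openVal_impl_eq_top.2 le_sup_right
  | orE φ ψ χ =>
    refine openVal_impl_eq_top.2 (le_himp_iff.2 (le_himp_iff.2 ?_))
    rintro x ⟨⟨h₁, h₂⟩, hx | hx⟩
    · exact Opens.mem_of_mem_himp h₁ hx
    · exact Opens.mem_of_mem_himp h₂ hx
  | botE φ => exact openVal_impl_eq_top.2 bot_le
  | nextBot => exact openVal_impl_eq_top.2 (map_bot (Opens.comap S)).le
  | nextAnd φ ψ => simp [Formula.iff, openVal]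
  | nextOr φ ψ => simp [Formula.iff, openVal]
  | nextK φ ψ =>
    refine openVal_impl_eq_top.2 (le_himp_iff.2 ?_)
    rintro x ⟨h, hx⟩
    exact Opens.mem_of_mem_himp (x := S x) h hx
  | boxK φ ψ =>
    refine openVal_impl_eq_top.2 (le_himp_iff.2 (le_openVal_box ?_ ?_))
    · rw [map_inf]
      exact inf_le_inf (openVal_box_le_comap _) (openVal_box_le_comap _)
    · exact (inf_le_inf (openVal_box_le _) (openVal_box_le _)).trans himp_inf_le
  | diamK φ ψ =>
    refine openVal_impl_eq_top.2 (le_himp_iff.2 ?_)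
    rintro x ⟨h, hx⟩
    obtain ⟨n, hn⟩ := mem_openVal_diam.1 hx
    exact mem_openVal_diam.2 ⟨n, Opens.mem_of_mem_himp
      (openVal_box_le _ (iterate_mem_of_le_comap (openVal_box_le_comap _) h n)) hn⟩
  | diamOr φ ψ =>
    refine openVal_impl_eq_top.2 fun x hx => ?_
    obtain ⟨n, hn | hn⟩ := mem_openVal_diam.1 hx
    · exact Or.inl (mem_openVal_diam.2 ⟨n, hn⟩)
    · exact Or.inr (mem_openVal_diam.2 ⟨n, hn⟩)
  | boxFix φ =>
    exact openVal_impl_eq_top.2 (le_inf (openVal_box_le φ) (openVal_box_le_comap φ))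
  | diamFix φ =>
    refine openVal_impl_eq_top.2 ?_
    rintro x (hx | hx)
    · exact mem_openVal_diam.2 ⟨0, hx⟩
    · obtain ⟨n, hn⟩ := mem_openVal_diam.1 (show S x ∈ openVal S v (.diam φ) from hx)
      exact mem_openVal_diam.2 ⟨n + 1, hn⟩
  | ind1 _ ih =>
    exact openVal_impl_eq_top.2 (le_openVal_box (openVal_impl_eq_top.1 ih) le_rfl)
  | ind2 _ ih =>
    refine openVal_impl_eq_top.2 fun x hx => ?_
    obtain ⟨n, hn⟩ := mem_openVal_diam.1 hx
    exact mem_of_iterate_mem_of_comap_le (openVal_impl_eq_top.1 ih) hn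
  | mp _ _ ih₁ ih₂ => exact top_le_iff.1 (ih₂ ▸ openVal_impl_eq_top.1 ih₁)
  | nec _ ih => rw [openVal, ih, map_top]

end Soundness

section Countermodel

/-- The doubling map `x ↦ 2 * x` on the real line. -/
noncomputable def doubling : C(ℝ, ℝ) := ⟨fun x => 2 * x, by fun_prop⟩

lemma doubling_apply (x : ℝ) : doubling x = 2 * x := rfl

lemma isOpenMap_doubling : IsOpenMap doubling :=
  (Homeomorph.mulLeft₀ (2 : ℝ) two_ne_zero).isOpenMap

lemma iterate_doubling (n : ℕ) (x : ℝ) : doubling^[n] x = 2 ^ n * x := by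
  induction n with
  | zero => simp
  | succ n ih => rw [Function.iterate_succ_apply', ih, doubling_apply]; ring

/-- The interpretation of `p` as `(-∞, 1)` and of every other variable as `(0, ∞)`. -/
def rayVal : ℕ → Opens ℝ
  | 0 => ⟨Set.Iio 1, isOpen_Iio⟩
  | _ + 1 => ⟨Set.Ioi 0, isOpen_Ioi⟩

lemma mem_openVal_pVar {x : ℝ} : x ∈ openVal doubling rayVal pVar ↔ x < 1 := Iff.rfl

lemma mem_openVal_qVar {x : ℝ} : x ∈ openVal doubling rayVal qVar ↔ 0 < x := Iff.rfl

lemma openVal_box_eq_top {X : Type*} [TopologicalSpace X] {S : C(X, X)} {v : ℕ → Opens X}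
    {φ : Formula} (h : openVal S v φ = ⊤) : openVal S v (.box φ) = ⊤ :=
  top_le_iff.1 (le_openVal_box (by simp) h.ge)

lemma openVal_box_pVar_or_qVar : openVal doubling rayVal (.box (.or pVar qVar)) = ⊤ := by
  refine openVal_box_eq_top (top_le_iff.1 fun x _ => ?_)
  rcases lt_or_ge x 1 with h | h
  · exact Or.inl h
  · exact Or.inr (mem_openVal_qVar.2 (one_pos.trans_le h))

lemma zero_notMem_openVal_box_pVar : (0 : ℝ) ∉ openVal doubling rayVal (.box pVar) := by
  intro h
  obtain ⟨ε, hε, hball⟩ := Metric.isOpen_iff.1 (openVal doubling rayVal (.box pVar)).isOpen 0 h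
  have hmem : ε / 2 ∈ openVal doubling rayVal (.box pVar) :=
    hball (by rw [mem_ball_zero_iff, Real.norm_of_nonneg (by positivity)]; linarith)
  obtain ⟨n, hn⟩ := pow_unbounded_of_one_lt (ε / 2)⁻¹ (one_lt_two : (1 : ℝ) < 2)
  have hlt := mem_openVal_pVar.1
    (openVal_box_le _ (iterate_mem_of_le_comap (openVal_box_le_comap _) hmem n))
  rw [iterate_doubling] at hlt
  exact hlt.not_gt ((inv_lt_iff_one_lt_mul₀ (by positivity)).1 hn)

end Countermodel

/-- Corollary 2: ITL^FS derives neither CD(p,q) nor BI(p,q). -/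
theorem itlfs_not_derives_cd_bi :
    ¬ ITLFS (.impl (.box (.or pVar qVar)) (.or (.box pVar) (.diam qVar))) ∧
    ¬ ITLFS (.impl
        (.and (.box (.or pVar qVar)) (.box (.impl (.next qVar) qVar)))
        (.or (.box pVar) qVar)) := by
  constructor
  · intro h
    have hle := openVal_impl_eq_top.1 (h.openVal_eq_top isOpenMap_doubling rayVal)
    rw [openVal_box_pVar_or_qVar] at hle
    rcases hle (Opens.mem_top (0 : ℝ)) with hp | hq
    · exact zero_notMem_openVal_box_pVar hp
    · obtain ⟨n, hn⟩ := mem_openVal_diam.1 hq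
      rw [iterate_doubling, mul_zero] at hn
      exact lt_irrefl _ (mem_openVal_qVar.1 hn)
  · intro h
    have hle := openVal_impl_eq_top.1 (h.openVal_eq_top isOpenMap_doubling rayVal)
    have hq : openVal doubling rayVal (.box (.impl (.next qVar) qVar)) = ⊤ := by
      refine openVal_box_eq_top (openVal_impl_eq_top.2 fun x hx => ?_)
      exact mem_openVal_qVar.2 (pos_of_mul_pos_right (mem_openVal_qVar.1 hx) zero_le_two)
    rcases hle ⟨openVal_box_pVar_or_qVar ▸ Opens.mem_top (0 : ℝ), hq ▸ Opens.mem_top (0 : ℝ)⟩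
      with hp | hq
    · exact zero_notMem_openVal_box_pVar hp
    · exact lt_irrefl _ (mem_openVal_qVar.1 hq)
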